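/- Let n ≥ 1 and j ∈ {1,…,n}. There exists a constant C > 0 such that for every i ∈ {1,…,n}, every t > 0, and all x, y ∈ ℝⁿ with x ≠ y, the function Ω_j(·,·,t) is partially differentiable in x_i and in y_i at (x,y), and (∫_0^∞ (∂_{x_i} Ω_j(x,y,t))² dt/t)^{1/2} + (∫_0^∞ (∂_{y_i} Ω_j(x,y,t))² dt/t)^{1/2} ≤ C / |x-y|^{n+1}. -/

import Mathlib

open Real MeasureTheory Set

/-- The Mehler (Hermite heat) kernel on ℝⁿ. -/
noncomputable def W (n : ℕ) (s : ℝ) (x y : EuclideanSpace ℝ (Fin n)) : ℝ :=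
  (Real.exp (-2 * s) / (Real.pi * (1 - Real.exp (-4 * s)))) ^ ((n : ℝ) / 2) *
    Real.exp (-(1 / 4) * ((1 + Real.exp (-2 * s)) / (1 - Real.exp (-2 * s)) * ‖x - y‖ ^ 2 +
      (1 - Real.exp (-2 * s)) / (1 + Real.exp (-2 * s)) * ‖x + y‖ ^ 2))

/-- A_{j,s}(x,y) = (∂_{x_j} + x_j) W_s(x,y). -/
noncomputable def A (n : ℕ) (j : Fin n) (s : ℝ) (x y : EuclideanSpace ℝ (Fin n)) : ℝ :=
  (x j - 1 / 2 * ((1 + Real.exp (-2 * s)) / (1 - Real.exp (-2 * s))) * (x j - y j) -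
    1 / 2 * ((1 - Real.exp (-2 * s)) / (1 + Real.exp (-2 * s))) * (x j + y j)) * W n s x y

/-- Ω_j(x,y,t) = t (∂_{x_j} + x_j) P_t^L(x,y), where P_t^L is the Hermite-Poisson kernel. -/
noncomputable def Omj (n : ℕ) (j : Fin n) (x y : EuclideanSpace ℝ (Fin n)) (t : ℝ) : ℝ :=
  t ^ 2 / Real.sqrt (4 * Real.pi) *
    ∫ s in Set.Ioi (0 : ℝ), s ^ (-(3 : ℝ) / 2) * Real.exp (-t ^ 2 / (4 * s)) * A n j s x y

/-- The factor `coth s`, written in terms of `e^{-2s}`. -/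
noncomputable def cothExp (s : ℝ) : ℝ := (1 + Real.exp (-2 * s)) / (1 - Real.exp (-2 * s))

/-- The derivative of `A n j s` at `(x, y)` in the direction `(v, w)`. -/
noncomputable def dirDerivA (n : ℕ) (j : Fin n) (s : ℝ) (x y v w : EuclideanSpace ℝ (Fin n)) : ℝ :=
  ((v j - 1 / 2 * ((1 + Real.exp (-2 * s)) / (1 - Real.exp (-2 * s))) * (v j - w j) -
      1 / 2 * ((1 - Real.exp (-2 * s)) / (1 + Real.exp (-2 * s))) * (v j + w j)) -
    1 / 2 * (x j - 1 / 2 * ((1 + Real.exp (-2 * s)) / (1 - Real.exp (-2 * s))) * (x j - y j) -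
      1 / 2 * ((1 - Real.exp (-2 * s)) / (1 + Real.exp (-2 * s))) * (x j + y j)) *
      ((1 + Real.exp (-2 * s)) / (1 - Real.exp (-2 * s)) * inner ℝ (x - y) (v - w) +
        (1 - Real.exp (-2 * s)) / (1 + Real.exp (-2 * s)) * inner ℝ (x + y) (v + w))) * W n s x y

theorem hasDerivAt_A (n : ℕ) (j : Fin n) (s : ℝ) (x y v w : EuclideanSpace ℝ (Fin n)) (u : ℝ) :
    HasDerivAt (fun u : ℝ => A n j s (x + u • v) (y + u • w))
      (dirDerivA n j s (x + u • v) (y + u • w) v w) u := by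
  have hx : HasDerivAt (fun u : ℝ => x + u • v) v u := by
    simpa using ((hasDerivAt_id u).smul_const v).const_add x
  have hy : HasDerivAt (fun u : ℝ => y + u • w) w u := by
    simpa using ((hasDerivAt_id u).smul_const w).const_add y
  have hxj : HasDerivAt (fun u : ℝ => (x + u • v) j) (v j) u := by
    simpa using ((hasDerivAt_id u).mul_const (v j)).const_add (x j)
  have hyj : HasDerivAt (fun u : ℝ => (y + u • w) j) (w j) u := by
    simpa using ((hasDerivAt_id u).mul_const (w j)).const_add (y j)
  have hd := (hx.sub hy).norm_sq
  have hs := (hx.add hy).norm_sq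
  unfold A dirDerivA W
  generalize (1 + Real.exp (-2 * s)) / (1 - Real.exp (-2 * s)) = a
  generalize (1 - Real.exp (-2 * s)) / (1 + Real.exp (-2 * s)) = b
  generalize (Real.exp (-2 * s) / (Real.pi * (1 - Real.exp (-4 * s)))) ^ ((n : ℝ) / 2) = K
  have hp := (hxj.sub ((hxj.sub hyj).const_mul (1 / 2 * a))).sub
    ((hxj.add hyj).const_mul (1 / 2 * b))
  have hw := ((((hd.const_mul a).add (hs.const_mul b)).const_mul (-(1 / 4))).exp).const_mul K
  refine (hp.mul hw).congr_deriv ?_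
  simp only [Pi.sub_apply, Pi.add_apply]
  ring

/-- A polynomial factor is absorbed by half of the Gaussian exponent. -/
theorem one_add_half_mul_exp_le (R : ℝ) :
    (1 + R / 2) * Real.exp (-(1 / 4) * R) ≤ 4 * Real.exp (-(1 / 8) * R) := by
  have h : 1 + R / 2 ≤ 4 * Real.exp (R / 8) := by
    have := Real.add_one_le_exp (R / 8)
    linarith
  calc (1 + R / 2) * Real.exp (-(1 / 4) * R)
      ≤ 4 * Real.exp (R / 8) * Real.exp (-(1 / 4) * R) := by gcongr
    _ = 4 * Real.exp (-(1 / 8) * R) := by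
      rw [mul_assoc, ← Real.exp_add]; ring_nf

theorem exp_neg_two_mul_mem {s : ℝ} (hs : 0 < s) :
    0 < Real.exp (-2 * s) ∧ Real.exp (-2 * s) < 1 :=
  ⟨Real.exp_pos _, Real.exp_lt_one_iff.mpr (by linarith)⟩

theorem one_le_cothExp {s : ℝ} (hs : 0 < s) : 1 ≤ cothExp s := by
  obtain ⟨h0, h1⟩ := exp_neg_two_mul_mem hs
  rw [cothExp, le_div_iff₀ (by linarith)]
  linarith

theorem inv_two_mul_le_cothExp {s : ℝ} (hs : 0 < s) : 1 / (2 * s) ≤ cothExp s := by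
  obtain ⟨h0, h1⟩ := exp_neg_two_mul_mem hs
  have h := Real.add_one_le_exp (-2 * s)
  rw [cothExp, div_le_div_iff₀ (by positivity) (by linarith)]
  nlinarith

/-- The normalising factor of the Mehler kernel. -/
noncomputable def mehlerFactor (n : ℕ) (s : ℝ) : ℝ :=
  (Real.exp (-2 * s) / (Real.pi * (1 - Real.exp (-4 * s)))) ^ ((n : ℝ) / 2)

theorem cothExp_mul_mehlerFactor_le {n : ℕ} (hn : 1 ≤ n) {s : ℝ} (hs : 0 < s) :
    cothExp s * mehlerFactor n s ≤ 3 * s ^ (-((n : ℝ) / 2 + 1)) := by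
  obtain ⟨h0, h1⟩ := exp_neg_two_mul_mem hs
  have ha := one_le_cothExp hs
  have hE4 : Real.exp (-4 * s) = Real.exp (-2 * s) ^ 2 := by
    rw [← Real.exp_nat_mul]; ring_nf
  have hE3 : Real.exp (-2 * s) = Real.exp (-(2 / 3) * s) ^ 3 := by
    rw [← Real.exp_nat_mul]; push_cast; ring_nf
  have hcube : s * Real.exp (-(2 / 3) * s) ≤ 3 / 2 * (1 - Real.exp (-2 * s)) := by
    have h2 := Real.add_one_le_exp (2 / 3 * s)
    have h3 : Real.exp (2 / 3 * s) * Real.exp (-(2 / 3) * s) = 1 := by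
      rw [← Real.exp_add]; simp
    have h4 : Real.exp (-2 * s) ≤ Real.exp (-(2 / 3) * s) := Real.exp_le_exp.mpr (by linarith)
    have h5 := Real.exp_pos (-(2 / 3) * s)
    nlinarith
  have hlin : s * Real.exp (-2 * s) ≤ 1 - Real.exp (-2 * s) := by
    have h2 := Real.add_one_le_exp (2 * s)
    have h3 : Real.exp (2 * s) * Real.exp (-2 * s) = 1 := by
      rw [← Real.exp_add]; simp
    nlinarith
  have hpow : s ^ 3 * Real.exp (-2 * s) ≤ 27 / 8 * (1 - Real.exp (-2 * s)) ^ 3 := by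
    have := pow_le_pow_left₀ (by positivity) hcube 3
    rw [mul_pow, mul_pow, ← hE3] at this
    linarith
  rw [mehlerFactor, hE4]
  set E := Real.exp (-2 * s) with hE
  have hpi := Real.pi_gt_three
  have hE1 : 0 < 1 - E := by linarith
  have hE2 : 0 < 1 - E ^ 2 := by nlinarith
  set q := E / (Real.pi * (1 - E ^ 2)) with hq
  have hqpos : 0 < q := by positivity
  have hqs : q ≤ s⁻¹ := by
    rw [hq, inv_eq_one_div, div_le_div_iff₀ (by positivity) hs]
    nlinarith [mul_pos hE1 h0]
  have haq : cothExp s ^ 2 * q ≤ 9 * (s⁻¹) ^ 3 := by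
    have e : cothExp s ^ 2 * q = (1 + E) * E / (Real.pi * (1 - E) ^ 3) := by
      have e2 : 1 - E ^ 2 = (1 - E) * (1 + E) := by ring
      rw [hq, cothExp, ← hE, e2]
      field_simp
    rw [e, inv_pow, ← div_eq_mul_inv, div_le_div_iff₀ (by positivity) (by positivity)]
    have : 0 < (1 - E) ^ 3 := by positivity
    nlinarith [mul_le_mul_of_nonneg_left hpow (by linarith : 0 ≤ 1 + E)]
  have hhalf : cothExp s * q ^ ((1 : ℝ) / 2) ≤ 3 * (s⁻¹) ^ ((3 : ℝ) / 2) := by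
    have e1 : cothExp s * q ^ ((1 : ℝ) / 2) = Real.sqrt (cothExp s ^ 2 * q) := by
      rw [Real.sqrt_mul (by positivity), Real.sqrt_sq (by linarith), Real.sqrt_eq_rpow]
    have e2 : 3 * (s⁻¹) ^ ((3 : ℝ) / 2) = Real.sqrt (9 * (s⁻¹) ^ 3) := by
      rw [Real.sqrt_mul (by norm_num), show (9 : ℝ) = 3 ^ 2 by norm_num,
        Real.sqrt_sq (by norm_num), Real.sqrt_eq_rpow, ← Real.rpow_natCast,
        ← Real.rpow_mul (by positivity)]
      norm_num
    rw [e1, e2]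
    exact Real.sqrt_le_sqrt haq
  have hn' : (1 : ℝ) ≤ n := by exact_mod_cast hn
  calc cothExp s * q ^ ((n : ℝ) / 2)
      = (cothExp s * q ^ ((1 : ℝ) / 2)) * q ^ (((n : ℝ) - 1) / 2) := by
        rw [mul_assoc, ← Real.rpow_add hqpos]; ring_nf
    _ ≤ (3 * (s⁻¹) ^ ((3 : ℝ) / 2)) * (s⁻¹) ^ (((n : ℝ) - 1) / 2) := by
        gcongr
    _ = 3 * s ^ (-((n : ℝ) / 2 + 1)) := by
        rw [mul_assoc, ← Real.rpow_add (by positivity), Real.inv_rpow hs.le, ← Real.rpow_neg hs.le]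
        ring_nf

theorem W_eq {n : ℕ} {s : ℝ} (x y : EuclideanSpace ℝ (Fin n)) :
    W n s x y = mehlerFactor n s *
      Real.exp (-(1 / 4) * (cothExp s * ‖x - y‖ ^ 2 + (cothExp s)⁻¹ * ‖x + y‖ ^ 2)) := by
  rw [W, mehlerFactor, cothExp, inv_div]

theorem mehlerFactor_nonneg {n : ℕ} {s : ℝ} (hs : 0 < s) : 0 ≤ mehlerFactor n s := by
  have h : Real.exp (-4 * s) < 1 := Real.exp_lt_one_iff.mpr (by linarith)
  have h' : 0 < 1 - Real.exp (-4 * s) := by linarith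
  unfold mehlerFactor
  positivity

theorem abs_apply_le_norm {n : ℕ} (z : EuclideanSpace ℝ (Fin n)) (j : Fin n) : |z j| ≤ ‖z‖ :=
  PiLp.norm_apply_le z j

/-- The linear factor of `A`, and of its derivative, in the coordinates `x - y` and `x + y`. -/
theorem abs_linearFactor_le {n : ℕ} (j : Fin n) (x y : EuclideanSpace ℝ (Fin n)) {a : ℝ}
    (ha : 1 ≤ a) :
    |x j - 1 / 2 * a * (x j - y j) - 1 / 2 * a⁻¹ * (x j + y j)| ≤
      1 / 2 * (a * ‖x - y‖ + ‖x + y‖) := by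
  have h1 := abs_apply_le_norm (x - y) j
  have h2 := abs_apply_le_norm (x + y) j
  rw [PiLp.sub_apply] at h1
  rw [PiLp.add_apply] at h2
  have hb : 0 < a⁻¹ := by positivity
  have hb1 : a⁻¹ ≤ 1 := inv_le_one_of_one_le₀ ha
  have e : x j - 1 / 2 * a * (x j - y j) - 1 / 2 * a⁻¹ * (x j + y j) =
      1 / 2 * ((1 - a) * (x j - y j) + (1 - a⁻¹) * (x j + y j)) := by ring
  rw [e, abs_mul, abs_of_pos (by norm_num : (0 : ℝ) < 1 / 2)]
  gcongr
  refine (abs_add_le _ _).trans (add_le_add ?_ ?_)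
  · rw [abs_mul]
    gcongr
    rw [abs_le]; constructor <;> linarith
  · rw [abs_mul]
    have : |1 - a⁻¹| ≤ 1 := by rw [abs_le]; constructor <;> linarith
    calc _ ≤ 1 * ‖x + y‖ := by gcongr
      _ = _ := one_mul _

theorem linearFactor_norm_le {a D S : ℝ} (ha : 1 ≤ a) :
    1 / 2 * (a * D + S) ≤ a * (1 + (a * D ^ 2 + a⁻¹ * S ^ 2) / 2) := by
  have ha0 : 0 < a := by linarith
  have h1 : 0 ≤ a * (D - 1) ^ 2 := by positivity
  have h2 : 0 ≤ a⁻¹ * (S - a) ^ 2 := by positivity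
  have e : a⁻¹ * (S - a) ^ 2 = a⁻¹ * S ^ 2 - 2 * S + a := by field_simp; ring
  have h3 : 0 ≤ a * D ^ 2 := by positivity
  have h4 : 0 ≤ a⁻¹ * S ^ 2 := by positivity
  nlinarith

theorem derivFactor_norm_le {a D S : ℝ} (ha : 1 ≤ a) :
    a + 1 / 2 * (1 / 2 * (a * D + S)) * (a * D + a⁻¹ * S) ≤
      a * (1 + (a * D ^ 2 + a⁻¹ * S ^ 2) / 2) := by
  have ha0 : 0 < a := by linarith
  have hP : 0 ≤ a * D ^ 2 := by positivity
  have hQ : 0 ≤ a⁻¹ * S ^ 2 := by positivity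
  have h : 0 ≤ a⁻¹ * (S - a * D) ^ 2 := by positivity
  have e : a⁻¹ * (S - a * D) ^ 2 = a⁻¹ * S ^ 2 - 2 * (D * S) + a * D ^ 2 := by
    field_simp; ring
  have e2 : (a * D + S) * (a * D + a⁻¹ * S) =
      a * (a * D ^ 2) + (1 + a) * (D * S) + a⁻¹ * S ^ 2 := by
    field_simp; ring
  have h3 : (1 + a) * (D * S) ≤ (1 + a) * ((a * D ^ 2 + a⁻¹ * S ^ 2) / 2) := by
    gcongr
    linarith
  nlinarith

theorem factor_mul_W_le {n : ℕ} (hn : 1 ≤ n) {s : ℝ} (hs : 0 < s)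
    (x y : EuclideanSpace ℝ (Fin n)) {p : ℝ}
    (hp : p ≤ cothExp s *
      (1 + (cothExp s * ‖x - y‖ ^ 2 + (cothExp s)⁻¹ * ‖x + y‖ ^ 2) / 2)) :
    p * W n s x y ≤
      12 * s ^ (-((n : ℝ) / 2 + 1)) * Real.exp (-(‖x - y‖ ^ 2 / (16 * s))) := by
  have ha := one_le_cothExp hs
  have ha0 : 0 < cothExp s := by linarith
  have hK := mehlerFactor_nonneg (n := n) hs
  rw [W_eq]
  set R := cothExp s * ‖x - y‖ ^ 2 + (cothExp s)⁻¹ * ‖x + y‖ ^ 2 with hR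
  have hQ : 0 ≤ (cothExp s)⁻¹ * ‖x + y‖ ^ 2 := by positivity
  have hR0 : 0 ≤ R := by positivity
  calc p * (mehlerFactor n s * Real.exp (-(1 / 4) * R))
      ≤ cothExp s * (1 + R / 2) * (mehlerFactor n s * Real.exp (-(1 / 4) * R)) := by gcongr
    _ = cothExp s * mehlerFactor n s * ((1 + R / 2) * Real.exp (-(1 / 4) * R)) := by ring
    _ ≤ (3 * s ^ (-((n : ℝ) / 2 + 1))) * (4 * Real.exp (-(‖x - y‖ ^ 2 / (16 * s)))) := by
        refine mul_le_mul (cothExp_mul_mehlerFactor_le hn hs) ?_ (by positivity) (by positivity)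
        refine (one_add_half_mul_exp_le R).trans ?_
        gcongr
        have := mul_le_mul_of_nonneg_right (inv_two_mul_le_cothExp hs) (sq_nonneg ‖x - y‖)
        have e : ‖x - y‖ ^ 2 / (16 * s) = 1 / 8 * (1 / (2 * s) * ‖x - y‖ ^ 2) := by
          field_simp; ring
        rw [e]
        linarith
    _ = _ := by ring

theorem W_nonneg {n : ℕ} {s : ℝ} (hs : 0 < s) (x y : EuclideanSpace ℝ (Fin n)) :
    0 ≤ W n s x y := by
  rw [W_eq]
  exact mul_nonneg (mehlerFactor_nonneg hs) (Real.exp_pos _).le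

theorem abs_A_le {n : ℕ} (hn : 1 ≤ n) (j : Fin n) {s : ℝ} (hs : 0 < s)
    (x y : EuclideanSpace ℝ (Fin n)) :
    |A n j s x y| ≤
      12 * s ^ (-((n : ℝ) / 2 + 1)) * Real.exp (-(‖x - y‖ ^ 2 / (16 * s))) := by
  have ha := one_le_cothExp hs
  rw [A, abs_mul, abs_of_nonneg (W_nonneg hs x y)]
  refine factor_mul_W_le hn hs x y (le_trans ?_ (linearFactor_norm_le ha))
  have := abs_linearFactor_le j x y ha
  rwa [cothExp, inv_div] at this

theorem abs_dirDerivA_le {n : ℕ} (hn : 1 ≤ n) (j : Fin n) {s : ℝ} (hs : 0 < s)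
    (x y : EuclideanSpace ℝ (Fin n)) {v w : EuclideanSpace ℝ (Fin n)} (hd : ‖v - w‖ ≤ 1)
    (ha : ‖v + w‖ ≤ 1) :
    |dirDerivA n j s x y v w| ≤
      12 * s ^ (-((n : ℝ) / 2 + 1)) * Real.exp (-(‖x - y‖ ^ 2 / (16 * s))) := by
  have h1 := one_le_cothExp hs
  rw [dirDerivA, abs_mul, abs_of_nonneg (W_nonneg hs x y)]
  refine factor_mul_W_le hn hs x y (le_trans ?_ (derivFactor_norm_le h1))
  have hb : (1 - Real.exp (-2 * s)) / (1 + Real.exp (-2 * s)) = (cothExp s)⁻¹ := by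
    rw [cothExp, inv_div]
  rw [hb, ← cothExp]
  have hx := abs_linearFactor_le j x y h1
  have hv := abs_linearFactor_le j v w h1
  have ha0 : 0 < cothExp s := by linarith
  have hi1 : |inner ℝ (x - y) (v - w)| ≤ ‖x - y‖ :=
    (abs_real_inner_le_norm _ _).trans (mul_le_of_le_one_right (norm_nonneg _) hd)
  have hi2 : |inner ℝ (x + y) (v + w)| ≤ ‖x + y‖ :=
    (abs_real_inner_le_norm _ _).trans (mul_le_of_le_one_right (norm_nonneg _) ha)
  refine (abs_sub _ _).trans (add_le_add ?_ ?_)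
  · refine hv.trans ?_
    nlinarith
  · rw [abs_mul, abs_mul, abs_of_pos (by norm_num : (0 : ℝ) < 1 / 2)]
    refine mul_le_mul (by gcongr) ?_ (abs_nonneg _) (by positivity)
    refine (abs_add_le _ _).trans (add_le_add ?_ ?_)
    · rw [abs_mul, abs_of_pos ha0]; gcongr
    · rw [abs_mul, abs_of_pos (inv_pos.mpr ha0)]; gcongr

theorem rpow_mul_exp_neg_div_eqOn (k M : ℝ) :
    EqOn (fun s : ℝ => (|(-1 : ℝ)| * s ^ ((-1 : ℝ) - 1)) •
        ((s ^ (-1 : ℝ)) ^ (k - 1) * Real.exp (-(M * s ^ (-1 : ℝ)))))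
      (fun s : ℝ => s ^ (-(k + 1)) * Real.exp (-(M / s))) (Ioi 0) := by
  intro s hs
  have hs : 0 < s := hs
  simp only [smul_eq_mul, abs_neg, abs_one, one_mul]
  rw [← Real.rpow_mul hs.le, ← mul_assoc, ← Real.rpow_add hs, Real.rpow_neg_one, div_eq_mul_inv]
  ring_nf

theorem integrableOn_rpow_mul_exp_neg_div {k M : ℝ} (hk : 0 < k) (hM : 0 < M) :
    IntegrableOn (fun s : ℝ => s ^ (-(k + 1)) * Real.exp (-(M / s))) (Ioi 0) := by
  rw [← integrableOn_congr_fun (rpow_mul_exp_neg_div_eqOn k M) measurableSet_Ioi,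
    integrableOn_Ioi_comp_rpow_iff (fun u : ℝ => u ^ (k - 1) * Real.exp (-(M * u)))
      (by norm_num : (-1 : ℝ) ≠ 0)]
  simpa using integrableOn_rpow_mul_exp_neg_mul_rpow (s := k - 1) (by linarith) one_pos hM

theorem integral_rpow_mul_exp_neg_div {k M : ℝ} (hk : 0 < k) (hM : 0 < M) :
    ∫ s in Ioi (0 : ℝ), s ^ (-(k + 1)) * Real.exp (-(M / s)) = (1 / M) ^ k * Real.Gamma k := by
  rw [← setIntegral_congr_fun measurableSet_Ioi (rpow_mul_exp_neg_div_eqOn k M),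
    integral_comp_rpow_Ioi (fun u : ℝ => u ^ (k - 1) * Real.exp (-(M * u)))
      (by norm_num : (-1 : ℝ) ≠ 0),
    Real.integral_rpow_mul_exp_neg_mul_Ioi hk hM]

theorem poissonWeight_mul_le {n : ℕ} {s t D f : ℝ} (hs : 0 < s)
    (hf : |f| ≤ 12 * s ^ (-((n : ℝ) / 2 + 1)) * Real.exp (-(D ^ 2 / (16 * s)))) :
    ‖s ^ (-(3 : ℝ) / 2) * Real.exp (-t ^ 2 / (4 * s)) * f‖ ≤
      12 * (s ^ (-(((n : ℝ) + 3) / 2 + 1)) * Real.exp (-((t ^ 2 + D ^ 2) / 16 / s))) := by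
  rw [Real.norm_eq_abs, abs_mul, abs_of_nonneg (by positivity)]
  have he : Real.exp (-t ^ 2 / (4 * s)) ≤ Real.exp (-(t ^ 2 / (16 * s))) := by
    rw [Real.exp_le_exp, neg_div, neg_le_neg_iff]
    gcongr
    norm_num
  calc s ^ (-(3 : ℝ) / 2) * Real.exp (-t ^ 2 / (4 * s)) * |f|
      ≤ s ^ (-(3 : ℝ) / 2) * Real.exp (-(t ^ 2 / (16 * s))) *
          (12 * s ^ (-((n : ℝ) / 2 + 1)) * Real.exp (-(D ^ 2 / (16 * s)))) := by gcongr
    _ = 12 * ((s ^ (-(3 : ℝ) / 2) * s ^ (-((n : ℝ) / 2 + 1))) *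
          (Real.exp (-(t ^ 2 / (16 * s))) * Real.exp (-(D ^ 2 / (16 * s))))) := by ring
    _ = _ := by
      rw [← Real.rpow_add hs, ← Real.exp_add]
      congr 3
      · ring
      · field_simp; ring

/-- The derivative of `Omj n j · · t` at `(x, y)` in the direction `(v, w)`. -/
noncomputable def dirDerivOmj (n : ℕ) (j : Fin n) (v w x y : EuclideanSpace ℝ (Fin n))
    (t : ℝ) : ℝ :=
  t ^ 2 / Real.sqrt (4 * Real.pi) *
    ∫ s in Set.Ioi (0 : ℝ),
      s ^ (-(3 : ℝ) / 2) * Real.exp (-t ^ 2 / (4 * s)) * dirDerivA n j s x y v w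

theorem hasDerivAt_Omj {n : ℕ} (hn : 1 ≤ n) (j : Fin n) (x y : EuclideanSpace ℝ (Fin n))
    {v w : EuclideanSpace ℝ (Fin n)} (hd : ‖v - w‖ ≤ 1) (ha : ‖v + w‖ ≤ 1) {t : ℝ} (ht : 0 < t) :
    HasDerivAt (fun u : ℝ => Omj n j (x + u • v) (y + u • w) t) (dirDerivOmj n j v w x y t) 0 := by
  have hweight {s f : ℝ} {x y : EuclideanSpace ℝ (Fin n)} (hs : 0 < s)
      (hf : |f| ≤ 12 * s ^ (-((n : ℝ) / 2 + 1)) * Real.exp (-(‖x - y‖ ^ 2 / (16 * s)))) :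
      ‖s ^ (-(3 : ℝ) / 2) * Real.exp (-t ^ 2 / (4 * s)) * f‖ ≤
        12 * (s ^ (-(((n : ℝ) + 3) / 2 + 1)) * Real.exp (-(t ^ 2 / 16 / s))) := by
    refine (poissonWeight_mul_le hs hf).trans ?_
    gcongr
    nlinarith [sq_nonneg ‖x - y‖]
  have hbound : IntegrableOn (fun s : ℝ =>
      12 * (s ^ (-(((n : ℝ) + 3) / 2 + 1)) * Real.exp (-(t ^ 2 / 16 / s)))) (Ioi 0) :=
    (integrableOn_rpow_mul_exp_neg_div (by positivity) (by positivity)).const_mul 12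
  have hmeas (x y : EuclideanSpace ℝ (Fin n)) : Measurable (fun s : ℝ =>
      s ^ (-(3 : ℝ) / 2) * Real.exp (-t ^ 2 / (4 * s)) * A n j s x y) := by
    unfold A W
    fun_prop
  have hmeas' : Measurable (fun s : ℝ => s ^ (-(3 : ℝ) / 2) * Real.exp (-t ^ 2 / (4 * s)) *
      dirDerivA n j s (x + (0 : ℝ) • v) (y + (0 : ℝ) • w) v w) := by
    unfold dirDerivA W
    fun_prop
  have key := hasDerivAt_integral_of_dominated_loc_of_deriv_le
    (μ := volume.restrict (Ioi (0 : ℝ))) (x₀ := (0 : ℝ)) (s := univ)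
    (F := fun u s => s ^ (-(3 : ℝ) / 2) * Real.exp (-t ^ 2 / (4 * s)) *
      A n j s (x + u • v) (y + u • w))
    (F' := fun u s => s ^ (-(3 : ℝ) / 2) * Real.exp (-t ^ 2 / (4 * s)) *
      dirDerivA n j s (x + u • v) (y + u • w) v w)
    Filter.univ_mem (Filter.Eventually.of_forall fun u => (hmeas _ _).aestronglyMeasurable)
    (hbound.mono' (hmeas _ _).aestronglyMeasurable
      ((ae_restrict_mem measurableSet_Ioi).mono fun s hs =>
        hweight hs (abs_A_le hn j hs _ _)))
    hmeas'.aestronglyMeasurable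
    ((ae_restrict_mem measurableSet_Ioi).mono fun s hs u _ =>
      hweight hs (abs_dirDerivA_le hn j hs _ _ hd ha))
    hbound
    (Filter.Eventually.of_forall fun s u _ => (hasDerivAt_A n j s x y v w u).const_mul _)
  simpa [Omj, dirDerivOmj] using key.2.const_mul (t ^ 2 / Real.sqrt (4 * Real.pi))

theorem abs_dirDerivOmj_le {n : ℕ} (hn : 1 ≤ n) (j : Fin n) (x y : EuclideanSpace ℝ (Fin n))
    {v w : EuclideanSpace ℝ (Fin n)} (hd : ‖v - w‖ ≤ 1) (ha : ‖v + w‖ ≤ 1) {t : ℝ} (ht : 0 < t) :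
    |dirDerivOmj n j v w x y t| ≤ 12 * Real.Gamma (((n : ℝ) + 3) / 2) * (t ^ 2 *
      (1 / ((t ^ 2 + ‖x - y‖ ^ 2) / 16)) ^ (((n : ℝ) + 3) / 2)) := by
  have hM : 0 < (t ^ 2 + ‖x - y‖ ^ 2) / 16 := by positivity
  have hk : 0 < ((n : ℝ) + 3) / 2 := by positivity
  have hint := norm_integral_le_of_norm_le
    ((integrableOn_rpow_mul_exp_neg_div hk hM).const_mul 12)
    ((ae_restrict_mem measurableSet_Ioi).mono fun s hs =>
      poissonWeight_mul_le (t := t) hs (abs_dirDerivA_le hn j hs x y hd ha))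
  rw [integral_const_mul, integral_rpow_mul_exp_neg_div hk hM, Real.norm_eq_abs] at hint
  have hpi : 1 ≤ Real.sqrt (4 * Real.pi) := by
    rw [Real.one_le_sqrt]
    linarith [Real.pi_gt_three]
  rw [dirDerivOmj, abs_mul, abs_of_nonneg (by positivity)]
  refine (mul_le_mul (div_le_self (sq_nonneg t) hpi) hint (abs_nonneg _) (sq_nonneg t)).trans
    (le_of_eq ?_)
  ring

theorem hasDerivAt_neg_inv_sq_add {c : ℝ} (hc : 0 < c) (t : ℝ) :
    HasDerivAt (fun t : ℝ => -(2 * (t ^ 2 + c))⁻¹) (t / (t ^ 2 + c) ^ 2) t := by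
  have h : t ^ 2 + c ≠ 0 := by positivity
  have h1 := ((((hasDerivAt_pow 2 t).add_const c).const_mul 2).inv (by positivity)).neg
  refine h1.congr_deriv ?_
  simp only [Nat.cast_ofNat]
  field_simp
  ring

theorem tendsto_neg_inv_sq_add (c : ℝ) :
    Filter.Tendsto (fun t : ℝ => -(2 * (t ^ 2 + c))⁻¹) Filter.atTop (nhds 0) := by
  rw [← neg_zero]
  refine (Filter.Tendsto.inv_tendsto_atTop ?_).neg
  exact (Filter.tendsto_atTop_add_const_right _ c
    (Filter.tendsto_pow_atTop two_ne_zero)).const_mul_atTop two_pos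

theorem integrableOn_Ioi_div_sq_add_sq {c : ℝ} (hc : 0 < c) :
    IntegrableOn (fun t : ℝ => t / (t ^ 2 + c) ^ 2) (Ioi 0) :=
  integrableOn_Ioi_deriv_of_nonneg (hasDerivAt_neg_inv_sq_add hc 0).continuousAt.continuousWithinAt
    (fun t _ => hasDerivAt_neg_inv_sq_add hc t)
    (fun t ht => by have : 0 < t := ht; positivity) (tendsto_neg_inv_sq_add c)

theorem integral_Ioi_div_sq_add_sq {c : ℝ} (hc : 0 < c) :
    ∫ t in Ioi (0 : ℝ), t / (t ^ 2 + c) ^ 2 = (2 * c)⁻¹ := by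
  rw [integral_Ioi_of_hasDerivAt_of_nonneg
    (hasDerivAt_neg_inv_sq_add hc 0).continuousAt.continuousWithinAt
    (fun t _ => hasDerivAt_neg_inv_sq_add hc t)
    (fun t ht => by have : 0 < t := ht; positivity) (tendsto_neg_inv_sq_add c)]
  simp

theorem dirDerivOmj_sq_div_le {n : ℕ} (hn : 1 ≤ n) (j : Fin n) {x y : EuclideanSpace ℝ (Fin n)}
    (hxy : x ≠ y) {v w : EuclideanSpace ℝ (Fin n)} (hd : ‖v - w‖ ≤ 1) (ha : ‖v + w‖ ≤ 1)
    {t : ℝ} (ht : 0 < t) :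
    dirDerivOmj n j v w x y t ^ 2 / t ≤
      (12 * Real.Gamma (((n : ℝ) + 3) / 2)) ^ 2 * 16 ^ (n + 3) / (‖x - y‖ ^ 2) ^ n *
        (t / (t ^ 2 + ‖x - y‖ ^ 2) ^ 2) := by
  have hD : 0 < ‖x - y‖ := norm_pos_iff.mpr (sub_ne_zero.mpr hxy)
  have hsq := pow_le_pow_left₀ (abs_nonneg _) (abs_dirDerivOmj_le hn j x y hd ha ht) 2
  set D := ‖x - y‖
  set G := 12 * Real.Gamma (((n : ℝ) + 3) / 2)
  have hpow : ((1 / ((t ^ 2 + D ^ 2) / 16)) ^ (((n : ℝ) + 3) / 2)) ^ 2 =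
      16 ^ (n + 3) / (t ^ 2 + D ^ 2) ^ (n + 3) := by
    rw [← Real.rpow_natCast, ← Real.rpow_mul (by positivity), one_div_div, ← div_pow,
      ← Real.rpow_natCast (16 / (t ^ 2 + D ^ 2))]
    congr 1
    push_cast
    ring
  rw [sq_abs, mul_pow G, mul_pow (t ^ 2), hpow] at hsq
  have hfrac : t ^ 3 / (t ^ 2 + D ^ 2) ^ (n + 3) ≤
      1 / (D ^ 2) ^ n * (t / (t ^ 2 + D ^ 2) ^ 2) := by
    rw [div_mul_div_comm, one_mul, div_le_div_iff₀ (by positivity) (by positivity)]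
    have h1 : (D ^ 2) ^ n ≤ (t ^ 2 + D ^ 2) ^ n :=
      pow_le_pow_left₀ (by positivity) (by nlinarith) n
    have h2 : t ^ 2 ≤ t ^ 2 + D ^ 2 := by nlinarith
    calc t ^ 3 * ((D ^ 2) ^ n * (t ^ 2 + D ^ 2) ^ 2)
        = t * (t ^ 2 * (D ^ 2) ^ n * (t ^ 2 + D ^ 2) ^ 2) := by ring
      _ ≤ t * ((t ^ 2 + D ^ 2) * (t ^ 2 + D ^ 2) ^ n * (t ^ 2 + D ^ 2) ^ 2) := by gcongr
      _ = t * (t ^ 2 + D ^ 2) ^ (n + 3) := by ring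
  calc dirDerivOmj n j v w x y t ^ 2 / t
      ≤ G ^ 2 * ((t ^ 2) ^ 2 * (16 ^ (n + 3) / (t ^ 2 + D ^ 2) ^ (n + 3))) / t := by gcongr
    _ = G ^ 2 * 16 ^ (n + 3) * (t ^ 3 / (t ^ 2 + D ^ 2) ^ (n + 3)) := by field_simp
    _ ≤ G ^ 2 * 16 ^ (n + 3) * (1 / (D ^ 2) ^ n * (t / (t ^ 2 + D ^ 2) ^ 2)) := by gcongr
    _ = _ := by ring

theorem sqrt_integral_dirDerivOmj_le {n : ℕ} (hn : 1 ≤ n) (j : Fin n)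
    {x y : EuclideanSpace ℝ (Fin n)} (hxy : x ≠ y) {v w : EuclideanSpace ℝ (Fin n)}
    (hd : ‖v - w‖ ≤ 1) (ha : ‖v + w‖ ≤ 1) :
    Real.sqrt (∫ t in Ioi (0 : ℝ), dirDerivOmj n j v w x y t ^ 2 / t) ≤
      12 * Real.Gamma (((n : ℝ) + 3) / 2) * 4 ^ (n + 3) / ‖x - y‖ ^ (n + 1) := by
  have hD : 0 < ‖x - y‖ := norm_pos_iff.mpr (sub_ne_zero.mpr hxy)
  have hG : 0 < Real.Gamma (((n : ℝ) + 3) / 2) := Real.Gamma_pos_of_pos (by positivity)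
  have hint := integral_mono_of_nonneg (μ := volume.restrict (Ioi (0 : ℝ)))
    ((ae_restrict_mem measurableSet_Ioi).mono fun t (ht : 0 < t) =>
      div_nonneg (sq_nonneg (dirDerivOmj n j v w x y t)) ht.le)
    ((integrableOn_Ioi_div_sq_add_sq (pow_pos hD 2)).const_mul
      ((12 * Real.Gamma (((n : ℝ) + 3) / 2)) ^ 2 * 16 ^ (n + 3) / (‖x - y‖ ^ 2) ^ n))
    ((ae_restrict_mem measurableSet_Ioi).mono fun t ht =>
      dirDerivOmj_sq_div_le hn j hxy hd ha ht)
  rw [integral_const_mul, integral_Ioi_div_sq_add_sq (pow_pos hD 2)] at hint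
  refine Real.sqrt_le_iff.mpr ⟨by positivity, hint.trans ?_⟩
  set D := ‖x - y‖
  set G := 12 * Real.Gamma (((n : ℝ) + 3) / 2)
  have e : (16 : ℝ) ^ (n + 3) = (4 ^ (n + 3)) ^ 2 := by
    rw [← pow_mul, mul_comm, pow_mul]; norm_num
  calc G ^ 2 * 16 ^ (n + 3) / (D ^ 2) ^ n * (2 * D ^ 2)⁻¹
      = 1 / 2 * (G * 4 ^ (n + 3) / D ^ (n + 1)) ^ 2 := by
        rw [e]; field_simp; ring
    _ ≤ (G * 4 ^ (n + 3) / D ^ (n + 1)) ^ 2 := by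
        linarith [sq_nonneg (G * 4 ^ (n + 3) / D ^ (n + 1))]

theorem Omj_gradient_H_norm_bound (n : ℕ) (hn : 1 ≤ n) (j : Fin n) :
    ∃ C > (0 : ℝ), ∀ i : Fin n,
      ∃ Dx Dy : EuclideanSpace ℝ (Fin n) → EuclideanSpace ℝ (Fin n) → ℝ → ℝ,
        ∀ x y : EuclideanSpace ℝ (Fin n), x ≠ y →
          (∀ t : ℝ, 0 < t →
            HasDerivAt (fun u : ℝ => Omj n j (x + u • EuclideanSpace.single i (1 : ℝ)) y t)
              (Dx x y t) 0 ∧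
            HasDerivAt (fun u : ℝ => Omj n j x (y + u • EuclideanSpace.single i (1 : ℝ)) t)
              (Dy x y t) 0) ∧
          Real.sqrt (∫ t in Set.Ioi (0 : ℝ), Dx x y t ^ 2 / t) +
              Real.sqrt (∫ t in Set.Ioi (0 : ℝ), Dy x y t ^ 2 / t) ≤
            C / ‖x - y‖ ^ (n + 1) := by
  have hG : 0 < Real.Gamma (((n : ℝ) + 3) / 2) := Real.Gamma_pos_of_pos (by positivity)
  refine ⟨2 * (12 * Real.Gamma (((n : ℝ) + 3) / 2) * 4 ^ (n + 3)), by positivity, fun i =>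
    ⟨dirDerivOmj n j (EuclideanSpace.single i 1) 0, dirDerivOmj n j 0 (EuclideanSpace.single i 1),
      fun x y hxy => ⟨fun t ht => ⟨?_, ?_⟩, ?_⟩⟩⟩
  · simpa using hasDerivAt_Omj hn j x y (v := EuclideanSpace.single i 1) (w := 0)
      (by simp) (by simp) ht
  · simpa using hasDerivAt_Omj hn j x y (v := 0) (w := EuclideanSpace.single i 1)
      (by simp) (by simp) ht
  · refine (add_le_add (sqrt_integral_dirDerivOmj_le hn j hxy (by simp) (by simp))
      (sqrt_integral_dirDerivOmj_le hn j hxy (by simp) (by simp))).trans (le_of_eq ?_)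
    ring
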